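/- Well-typedness does not imply deadlock freedom in the session π-calculus: the process (νx₁x₂)(νy₁y₂)( x₁?(z).y₁!⟨z⟩.0 | y₂?(w).x₂!⟨w⟩.0 ) is well-typed under the empty context (typing the endpoints at types x₁ : ?Unit.end, x₂ : !Unit.end, y₁ : !Unit.end, y₂ : ?Unit.end before applying the restriction rules), yet it admits no reduction step: there is no process Q with P → Q. -/

import Mathlib

/-! Session types and standard linear π-types, duality, encoding. -/

namespace SessionPi

mutual
/-- Session types: `end`, `!T.S`, `?T.S`, select `⊕{lᵢ : Sᵢ}_{i∈I}`, branch `&{lᵢ : Sᵢ}_{i∈I}`.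
Labels are natural numbers; the index set `I` is a finite set of labels. -/
inductive SType : Type
  | done : SType                                   -- end
  | send : Ty → SType → SType                      -- !T.S
  | recv : Ty → SType → SType                      -- ?T.S
  | sel  : (I : Finset ℕ) → (∀ i ∈ I, SType) → SType  -- ⊕{lᵢ : Sᵢ}
  | bra  : (I : Finset ℕ) → (∀ i ∈ I, SType) → SType  -- &{lᵢ : Sᵢ}

/-- Types: session types, standard channel types `#T`, `Unit`. -/
inductive Ty : Type
  | session : SType → Ty
  | chan : Ty → Ty
  | unit : Ty
end

/-- Duality on session types. -/
def dual : SType → SType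
  | .done => .done
  | .send T S => .recv T (dual S)
  | .recv T S => .send T (dual S)
  | .sel I f => .bra I (fun i h => dual (f i h))
  | .bra I f => .sel I (fun i h => dual (f i h))

/-- Linear π-types: `ℓo[t̄]`, `ℓi[t̄]`, `∅[]`, variants, connections `#[t̄]`, `Unit`. -/
inductive PiTy : Type
  | lout : (n : ℕ) → (Fin n → PiTy) → PiTy           -- ℓo[t₁,…,tₙ]
  | lin  : (n : ℕ) → (Fin n → PiTy) → PiTy           -- ℓi[t₁,…,tₙ]
  | noCap : PiTy                                      -- ∅[]
  | variant : (I : Finset ℕ) → (∀ i ∈ I, PiTy) → PiTy -- ⟨lᵢ : tᵢ⟩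
  | conn : (n : ℕ) → (Fin n → PiTy) → PiTy            -- #[t₁,…,tₙ]
  | unit : PiTy

/-- The (partial) involution `overline` swapping the outermost input/output capability. -/
def flipCap : PiTy → PiTy
  | .lin n ts => .lout n ts
  | .lout n ts => .lin n ts
  | t => t

mutual
/-- Encoding of session types into linear π-types:
`⟦end⟧ = ∅[]`, `⟦!T.S⟧ = ℓo[⟦T⟧,⟦dual S⟧]`, `⟦?T.S⟧ = ℓi[⟦T⟧,⟦S⟧]`,
`⟦⊕{lᵢ:Sᵢ}⟧ = ℓo[⟨lᵢ:⟦dual Sᵢ⟧⟩]`, `⟦&{lᵢ:Sᵢ}⟧ = ℓi[⟨lᵢ:⟦Sᵢ⟧⟩]`.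
(`encDS` implements `S ↦ ⟦dual S⟧`; see `encDS_eq` below.) -/
def encS : SType → PiTy
  | .done => .noCap
  | .send T S => .lout 2 ![encTy T, encDS S]
  | .recv T S => .lin 2 ![encTy T, encS S]
  | .sel I f => .lout 1 ![.variant I (fun i h => encDS (f i h))]
  | .bra I f => .lin 1 ![.variant I (fun i h => encS (f i h))]

/-- `encDS S = encS (dual S)` (proved below in `encDS_eq`). -/
def encDS : SType → PiTy
  | .done => .noCap
  | .send T S => .lin 2 ![encTy T, encDS S]
  | .recv T S => .lout 2 ![encTy T, encS S]
  | .sel I f => .lin 1 ![.variant I (fun i h => encDS (f i h))]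
  | .bra I f => .lout 1 ![.variant I (fun i h => encS (f i h))]

/-- Encoding of types, homomorphic on non-session constructs. -/
def encTy : Ty → PiTy
  | .session S => encS S
  | .chan T => .conn 1 ![encTy T]
  | .unit => .unit
end

theorem encDS_eq : ∀ S : SType, encDS S = encS (dual S) ∧ encDS (dual S) = encS S := by
  intro S
  induction S using SType.rec (motive_2 := fun _ => True) with
  | done => simp [encDS, encS, dual]
  | send T S ihT ihS =>
      constructor <;> (simp only [encDS, encS, dual]; rw [ihS.1])
  | recv T S ihT ihS =>
      constructor <;> (simp only [encDS, encS, dual]; rw [ihS.2])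
  | sel I f ih =>
      have h1 : (fun i h => encDS (f i h)) = (fun i h => encS (dual (f i h))) := by
        funext i h; exact (ih i h).1
      constructor <;> (simp only [encDS, encS, dual]; rw [h1])
  | bra I f ih =>
      have h2 : (fun i h => encDS (dual (f i h))) = (fun i h => encS (f i h)) := by
        funext i h; exact (ih i h).2
      constructor <;> (simp only [encDS, encS, dual]; rw [h2])
  | session S ih => trivial
  | chan T ih => trivial
  | unit => trivial

/-! ### Session π-calculus processes -/

/-- Values of the session π-calculus: names and the unit value `★`. -/
inductive SVal : Type
  | name : ℕ → SVal
  | star : SVal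
deriving DecidableEq

/-- Session π-calculus processes. `resS x y P` is the session restriction
`(νxy)P` binding the two endpoints `x` and `y`; `resC x P` is channel
restriction `(νx)P`. -/
inductive SProc : Type
  | send : ℕ → SVal → SProc → SProc                    -- x!⟨v⟩.P
  | recv : ℕ → ℕ → SProc → SProc                       -- x?(y).P
  | sel  : ℕ → ℕ → SProc → SProc                       -- x ◁ l_j.P
  | bra  : ℕ → (I : Finset ℕ) → (∀ i ∈ I, SProc) → SProc  -- x ▷ {lᵢ : Pᵢ}
  | nil  : SProc                                       -- 0
  | par  : SProc → SProc → SProc                       -- P | Q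
  | resS : ℕ → ℕ → SProc → SProc                       -- (νxy)P
  | resC : ℕ → SProc → SProc                           -- (νx)P

/-- Names of a value. -/
def fnV : SVal → Finset ℕ
  | .name x => {x}
  | .star => ∅

/-- Free names of a session process. -/
def fnS : SProc → Finset ℕ
  | .send x v P => insert x (fnV v ∪ fnS P)
  | .recv x y P => insert x (fnS P \ {y})
  | .sel x _ P => insert x (fnS P)
  | .bra x I f => insert x (I.attach.sup fun i => fnS (f i.1 i.2))
  | .nil => ∅
  | .par P Q => fnS P ∪ fnS Q
  | .resS x y P => fnS P \ {x, y}
  | .resC x P => fnS P \ {x}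

/-- Bound names of a session process. -/
def bnS : SProc → Finset ℕ
  | .send _ _ P => bnS P
  | .recv _ y P => insert y (bnS P)
  | .sel _ _ P => bnS P
  | .bra _ I f => I.attach.sup fun i => bnS (f i.1 i.2)
  | .nil => ∅
  | .par P Q => bnS P ∪ bnS Q
  | .resS x y P => insert x (insert y (bnS P))
  | .resC x P => insert x (bnS P)

/-- All names (free and bound) of a session process: `var P`. -/
def namesS (P : SProc) : Finset ℕ := fnS P ∪ bnS P

/-- Substitution of value `v` for name `z` in a name (channel) position. -/
def svn (z : ℕ) (v : SVal) (x : ℕ) : ℕ :=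
  if x = z then (match v with | .name n => n | .star => x) else x

/-- Substitution of value `v` for name `z` in a value. -/
def svv (z : ℕ) (v : SVal) : SVal → SVal
  | .name y => if y = z then v else .name y
  | .star => .star

/-- Substitution `P[v/z]` in session processes (binders shadow). -/
def ssubst (z : ℕ) (v : SVal) : SProc → SProc
  | .send x w P => .send (svn z v x) (svv z v w) (ssubst z v P)
  | .recv x y P => .recv (svn z v x) y (if y = z then P else ssubst z v P)
  | .sel x l P => .sel (svn z v x) l (ssubst z v P)
  | .bra x I f => .bra (svn z v x) I (fun i h => ssubst z v (f i h))
  | .nil => .nil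
  | .par P Q => .par (ssubst z v P) (ssubst z v Q)
  | .resS x y P => .resS x y (if x = z ∨ y = z then P else ssubst z v P)
  | .resC x P => .resC x (if x = z then P else ssubst z v P)

/-- Structural congruence `≡` of the session π-calculus: the least congruence
(including α-renaming of bound names) making parallel composition commutative,
associative, with unit `0`, and allowing scope extrusion and removal of
useless restrictions. -/
inductive SCong : SProc → SProc → Prop
  | refl : ∀ P, SCong P P
  | symm : ∀ {P Q}, SCong P Q → SCong Q P
  | trans : ∀ {P Q R}, SCong P Q → SCong Q R → SCong P R
  -- congruence rules
  | send : ∀ {P Q} x v, SCong P Q → SCong (.send x v P) (.send x v Q)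
  | recv : ∀ {P Q} x y, SCong P Q → SCong (.recv x y P) (.recv x y Q)
  | sel : ∀ {P Q} x l, SCong P Q → SCong (.sel x l P) (.sel x l Q)
  | bra : ∀ x (I : Finset ℕ) (f g : ∀ i ∈ I, SProc),
      (∀ i (h : i ∈ I), SCong (f i h) (g i h)) → SCong (.bra x I f) (.bra x I g)
  | par : ∀ {P P' Q Q'}, SCong P P' → SCong Q Q' → SCong (.par P Q) (.par P' Q')
  | resS : ∀ {P Q} x y, SCong P Q → SCong (.resS x y P) (.resS x y Q)
  | resC : ∀ {P Q} x, SCong P Q → SCong (.resC x P) (.resC x Q)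
  -- monoid laws for parallel composition
  | parComm : ∀ P Q, SCong (.par P Q) (.par Q P)
  | parAssoc : ∀ P Q R, SCong (.par (.par P Q) R) (.par P (.par Q R))
  | parNil : ∀ P, SCong (.par P .nil) P
  -- scope extrusion
  | scopeC : ∀ {x P Q}, x ∉ fnS Q → SCong (.par (.resC x P) Q) (.resC x (.par P Q))
  | scopeS : ∀ {x y P Q}, x ∉ fnS Q → y ∉ fnS Q →
      SCong (.par (.resS x y P) Q) (.resS x y (.par P Q))
  -- removal of useless restrictions
  | nilResC : ∀ x, SCong (.resC x .nil) .nil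
  | nilResS : ∀ x y, SCong (.resS x y .nil) .nil
  -- α-conversion of bound names
  | alphaRecv : ∀ {x y y' P}, y' ∉ namesS P →
      SCong (.recv x y P) (.recv x y' (ssubst y (.name y') P))
  | alphaResC : ∀ {x x' P}, x' ∉ namesS P →
      SCong (.resC x P) (.resC x' (ssubst x (.name x') P))
  | alphaResS : ∀ {x y x' y' P}, x' ∉ namesS P → y' ∉ namesS P → x' ≠ y' →
      SCong (.resS x y P) (.resS x' y' (ssubst y (.name y') (ssubst x (.name x') P)))

/-- Reduction relation `→` of the session π-calculus. -/
inductive SRed : SProc → SProc → Prop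
  | stndCom : ∀ x v z P Q,
      SRed (.par (.send x v P) (.recv x z Q)) (.par P (ssubst z v Q))
  | com : ∀ x y v z P Q,
      SRed (.resS x y (.par (.send x v P) (.recv y z Q)))
           (.resS x y (.par P (ssubst z v Q)))
  | case : ∀ x y j (I : Finset ℕ) P (f : ∀ i ∈ I, SProc) (h : j ∈ I),
      SRed (.resS x y (.par (.sel x j P) (.bra y I f)))
           (.resS x y (.par P (f j h)))
  | resC : ∀ {P Q} x, SRed P Q → SRed (.resC x P) (.resC x Q)
  | resS : ∀ {P Q} x y, SRed P Q → SRed (.resS x y P) (.resS x y Q)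
  | par : ∀ {P Q} R, SRed P Q → SRed (.par P R) (.par Q R)
  | struct : ∀ {P P' Q Q'}, SCong P P' → SRed P' Q' → SCong Q' Q → SRed P Q

/-! ### Session typing -/

/-- Session typing contexts. -/
def SCtx : Type := ℕ → Option Ty

/-- Unrestricted types: non-session types and the terminated session type `end`
may be weakened and shared. -/
def Ty.unr : Ty → Prop
  | .session S => S = .done
  | _ => True

/-- A context containing only unrestricted types. -/
def unrSCtx (Γ : SCtx) : Prop := ∀ x T, Γ x = some T → T.unr

/-- Context update `Γ, x : T`. -/
def supd (Γ : SCtx) (x : ℕ) (T : Ty) : SCtx := fun y => if y = x then some T else Γ y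

/-- Linear context splitting: `Γ = Γ₁ ∘ Γ₂`.  Unrestricted entries may be
shared; each linear (session) entry goes to exactly one side. -/
def SSplit (Γ Γ₁ Γ₂ : SCtx) : Prop := ∀ x,
  (Γ₁ x = Γ x ∧ Γ₂ x = Γ x ∧ ∀ T, Γ x = some T → T.unr)
  ∨ (Γ₁ x = Γ x ∧ Γ₂ x = none)
  ∨ (Γ₂ x = Γ x ∧ Γ₁ x = none)

/-- Typing of values in the session π-calculus. -/
inductive SVTyped : SCtx → SVal → Ty → Prop
  | name : ∀ {Γ : SCtx} {x T}, Γ x = some T →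
      (∀ y, y ≠ x → ∀ T', Γ y = some T' → Ty.unr T') → SVTyped Γ (.name x) T
  | star : ∀ {Γ : SCtx}, unrSCtx Γ → SVTyped Γ .star .unit

/-- Typing judgment `Γ ⊢ P` of the session π-calculus. -/
inductive STyped : SCtx → SProc → Prop
  | nil : ∀ {Γ}, unrSCtx Γ → STyped Γ .nil
  | send : ∀ {Γ Γ₁ Γ₂ : SCtx} {x v T S P}, SSplit Γ Γ₁ Γ₂ →
      SVTyped Γ₁ v T → Γ₂ x = some (.session (.send T S)) →
      STyped (supd Γ₂ x (.session S)) P → STyped Γ (.send x v P)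
  | recv : ∀ {Γ : SCtx} {x y T S P}, Γ x = some (.session (.recv T S)) →
      y ≠ x → Γ y = none →
      STyped (supd (supd Γ x (.session S)) y T) P → STyped Γ (.recv x y P)
  | sel : ∀ {Γ : SCtx} {x j} {I : Finset ℕ} {f : ∀ i ∈ I, SType} {P} (h : j ∈ I),
      Γ x = some (.session (.sel I f)) →
      STyped (supd Γ x (.session (f j h))) P → STyped Γ (.sel x j P)
  | bra : ∀ {Γ : SCtx} {x} {I : Finset ℕ} {f : ∀ i ∈ I, SType} {g : ∀ i ∈ I, SProc},
      Γ x = some (.session (.bra I f)) →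
      (∀ i (h : i ∈ I), STyped (supd Γ x (.session (f i h))) (g i h)) →
      STyped Γ (.bra x I g)
  | par : ∀ {Γ Γ₁ Γ₂ : SCtx} {P Q}, SSplit Γ Γ₁ Γ₂ →
      STyped Γ₁ P → STyped Γ₂ Q → STyped Γ (.par P Q)
  | resS : ∀ {Γ : SCtx} {x y} {T : SType} {P}, x ≠ y → Γ x = none → Γ y = none →
      STyped (supd (supd Γ x (.session T)) y (.session (dual T))) P →
      STyped Γ (.resS x y P)
  | resC : ∀ {Γ : SCtx} {x} {T : Ty} {P}, Γ x = none →
      STyped (supd Γ x (.chan T)) P → STyped Γ (.resC x P)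

/-! ### Standard linear π-calculus processes -/

/-- Values of the standard π-calculus: names, the unit value, variant values `l_v`. -/
inductive PVal : Type
  | name : ℕ → PVal
  | star : PVal
  | variant : ℕ → PVal → PVal

/-- Standard linear π-calculus processes, with polyadic communication and `case`. -/
inductive PProc : Type
  | send : ℕ → List PVal → PProc → PProc                 -- x!⟨v₁,…,vₙ⟩.P
  | recv : ℕ → List ℕ → PProc → PProc                    -- x?(y₁,…,yₙ).P
  | res  : ℕ → PProc → PProc                             -- (νx)P
  | nil  : PProc                                         -- 0
  | par  : PProc → PProc → PProc                         -- P | Q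
  | case : PVal → (I : Finset ℕ) → (∀ i ∈ I, ℕ) → (∀ i ∈ I, PProc) → PProc
      -- case v of {lᵢ(xᵢ) ▷ Pᵢ}

/-- Names of a π-calculus value. -/
def fnPV : PVal → Finset ℕ
  | .name x => {x}
  | .star => ∅
  | .variant _ v => fnPV v

/-- Free names of a π-calculus process. -/
def fnP : PProc → Finset ℕ
  | .send x vs P => insert x ((vs.foldr (fun v s => fnPV v ∪ s) ∅) ∪ fnP P)
  | .recv x ys P => insert x (fnP P \ ys.toFinset)
  | .res x P => fnP P \ {x}
  | .nil => ∅
  | .par P Q => fnP P ∪ fnP Q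
  | .case v I g f => fnPV v ∪ I.attach.sup (fun i => fnP (f i.1 i.2) \ {g i.1 i.2})

/-- All names (free and bound) of a π-calculus process. -/
def namesP : PProc → Finset ℕ
  | .send x vs P => insert x ((vs.foldr (fun v s => fnPV v ∪ s) ∅) ∪ namesP P)
  | .recv x ys P => insert x (ys.toFinset ∪ namesP P)
  | .res x P => insert x (namesP P)
  | .nil => ∅
  | .par P Q => namesP P ∪ namesP Q
  | .case v I g f => fnPV v ∪ I.attach.sup (fun i => insert (g i.1 i.2) (namesP (f i.1 i.2)))

/-- Application of a simultaneous substitution to a name (channel) position. -/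
def pavn (σ : ℕ → Option PVal) (x : ℕ) : ℕ :=
  match σ x with | some (.name y) => y | _ => x

/-- Application of a simultaneous substitution to a value. -/
def pavv (σ : ℕ → Option PVal) : PVal → PVal
  | .name x => (σ x).getD (.name x)
  | .star => .star
  | .variant l v => .variant l (pavv σ v)

/-- Simultaneous substitution in π-calculus processes (binders shadow). -/
def psubst (σ : ℕ → Option PVal) : PProc → PProc
  | .send x vs P => .send (pavn σ x) (vs.map (pavv σ)) (psubst σ P)
  | .recv x ys P => .recv (pavn σ x) ys (psubst (fun z => if z ∈ ys then none else σ z) P)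
  | .res x P => .res x (psubst (fun z => if z = x then none else σ z) P)
  | .nil => .nil
  | .par P Q => .par (psubst σ P) (psubst σ Q)
  | .case v I g f => .case (pavv σ v) I g
      (fun i h => psubst (fun z => if z = g i h then none else σ z) (f i h))

/-- The substitution `[v̄/z̄]` determined by lists of names and values. -/
def substOf (zs : List ℕ) (vs : List PVal) : ℕ → Option PVal :=
  fun x => List.lookup x (zs.zip vs)

/-- The single substitution `[v/z]`. -/
def subst1 (z : ℕ) (v : PVal) : ℕ → Option PVal :=
  fun x => if x = z then some v else none

/-- Structural congruence `≡` of the standard π-calculus: the least congruence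
(including α-renaming of bound names) making parallel composition commutative,
associative, with unit `0`, and allowing scope extrusion and removal of
useless restrictions. -/
inductive PCong : PProc → PProc → Prop
  | refl : ∀ P, PCong P P
  | symm : ∀ {P Q}, PCong P Q → PCong Q P
  | trans : ∀ {P Q R}, PCong P Q → PCong Q R → PCong P R
  -- congruence rules
  | send : ∀ {P Q} x vs, PCong P Q → PCong (.send x vs P) (.send x vs Q)
  | recv : ∀ {P Q} x ys, PCong P Q → PCong (.recv x ys P) (.recv x ys Q)
  | res : ∀ {P Q} x, PCong P Q → PCong (.res x P) (.res x Q)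
  | par : ∀ {P P' Q Q'}, PCong P P' → PCong Q Q' → PCong (.par P Q) (.par P' Q')
  | case : ∀ v (I : Finset ℕ) (g : ∀ i ∈ I, ℕ) (f f' : ∀ i ∈ I, PProc),
      (∀ i (h : i ∈ I), PCong (f i h) (f' i h)) → PCong (.case v I g f) (.case v I g f')
  -- monoid laws for parallel composition
  | parComm : ∀ P Q, PCong (.par P Q) (.par Q P)
  | parAssoc : ∀ P Q R, PCong (.par (.par P Q) R) (.par P (.par Q R))
  | parNil : ∀ P, PCong (.par P .nil) P
  -- scope extrusion and useless restrictions
  | scope : ∀ {x P Q}, x ∉ fnP Q → PCong (.par (.res x P) Q) (.res x (.par P Q))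
  | nilRes : ∀ x, PCong (.res x .nil) .nil
  -- α-conversion of bound names
  | alphaRes : ∀ {x x' P}, x' ∉ namesP P →
      PCong (.res x P) (.res x' (psubst (subst1 x (.name x')) P))
  | alphaRecv : ∀ {x ys y y' P}, y ∈ ys → y' ∉ namesP P → y' ∉ ys →
      PCong (.recv x ys P)
            (.recv x (ys.map fun z => if z = y then y' else z) (psubst (subst1 y (.name y')) P))
  | alphaCase : ∀ v (I : Finset ℕ) (g g' : ∀ i ∈ I, ℕ) (f f' : ∀ i ∈ I, PProc),
      (∀ i (h : i ∈ I),
        (g' i h = g i h ∧ f' i h = f i h) ∨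
        (g' i h ∉ namesP (f i h) ∧ f' i h = psubst (subst1 (g i h) (.name (g' i h))) (f i h))) →
      PCong (.case v I g f) (.case v I g' f')

/-- Reduction relation `→` of the standard π-calculus. -/
inductive PRed : PProc → PProc → Prop
  | com : ∀ x (vs : List PVal) (zs : List ℕ) P Q, zs.length = vs.length →
      PRed (.par (.send x vs P) (.recv x zs Q)) (.par P (psubst (substOf zs vs) Q))
  | case : ∀ j v (I : Finset ℕ) (g : ∀ i ∈ I, ℕ) (f : ∀ i ∈ I, PProc) (h : j ∈ I),
      PRed (.case (.variant j v) I g f) (psubst (subst1 (g j h) v) (f j h))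
  | res : ∀ {P Q} x, PRed P Q → PRed (.res x P) (.res x Q)
  | par : ∀ {P Q} R, PRed P Q → PRed (.par P R) (.par Q R)
  | struct : ∀ {P P' Q Q'}, PCong P P' → PRed P' Q' → PCong Q' Q → PRed P Q

/-- The relation `↪`: structural congruence extended with case normalisation,
closed under contexts and transitivity. -/
inductive Hook : PProc → PProc → Prop
  | cong : ∀ {P Q}, PCong P Q → Hook P Q
  | caseNorm : ∀ j v (I : Finset ℕ) (g : ∀ i ∈ I, ℕ) (f : ∀ i ∈ I, PProc) (h : j ∈ I),
      Hook (.case (.variant j v) I g f) (psubst (subst1 (g j h) v) (f j h))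
  | res : ∀ {P Q} x, Hook P Q → Hook (.res x P) (.res x Q)
  | par : ∀ {P Q} R, Hook P Q → Hook (.par P R) (.par Q R)
  | trans : ∀ {P Q R}, Hook P Q → Hook Q R → Hook P R

/-! ### Linear π typing -/

/-- Linear π typing contexts. -/
def PCtx : Type := ℕ → Option PiTy

/-- Unrestricted linear π-types: everything except the linear input/output types. -/
def PiTy.unr : PiTy → Prop
  | .lin _ _ => False
  | .lout _ _ => False
  | _ => True

/-- A linear π context containing only unrestricted types. -/
def unrPCtx (Δ : PCtx) : Prop := ∀ x t, Δ x = some t → PiTy.unr t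

/-- Context update `Δ, x : t`. -/
def pupd (Δ : PCtx) (x : ℕ) (t : PiTy) : PCtx := fun y => if y = x then some t else Δ y

/-- Context update with a list of (bound) names and their types. -/
def pupdL (Δ : PCtx) (ys : List ℕ) (ts : List PiTy) : PCtx := fun z =>
  match List.lookup z (ys.zip ts) with
  | some t => some t
  | none => Δ z

/-- Linear context splitting for the linear π-calculus. -/
def PSplit (Δ Δ₁ Δ₂ : PCtx) : Prop := ∀ x,
  (Δ₁ x = Δ x ∧ Δ₂ x = Δ x ∧ ∀ t, Δ x = some t → PiTy.unr t)
  ∨ (Δ₁ x = Δ x ∧ Δ₂ x = none)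
  ∨ (Δ₂ x = Δ x ∧ Δ₁ x = none)

/-- The context `Δ` provides exactly the (linear) entry `x : t`,
everything else being unrestricted. -/
def onlyAt (Δ : PCtx) (x : ℕ) (t : PiTy) : Prop :=
  Δ x = some t ∧ ∀ y, y ≠ x → ∀ t', Δ y = some t' → PiTy.unr t'

/-- Typing of values in the linear π-calculus. -/
inductive PVTyped : PCtx → PVal → PiTy → Prop
  | name : ∀ {Δ : PCtx} {x t}, Δ x = some t →
      (∀ y, y ≠ x → ∀ t', Δ y = some t' → PiTy.unr t') → PVTyped Δ (.name x) t
  | star : ∀ {Δ}, unrPCtx Δ → PVTyped Δ .star .unit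
  | variant : ∀ {Δ : PCtx} {j v} {I : Finset ℕ} {ts : ∀ i ∈ I, PiTy} (h : j ∈ I),
      PVTyped Δ v (ts j h) → PVTyped Δ (.variant j v) (.variant I ts)

/-- Typing of lists of values (splitting the context among them). -/
inductive PVsTyped : PCtx → List PVal → List PiTy → Prop
  | nil : ∀ {Δ}, unrPCtx Δ → PVsTyped Δ [] []
  | cons : ∀ {Δ Δ₁ Δ₂ : PCtx} {v t vs ts}, PSplit Δ Δ₁ Δ₂ →
      PVTyped Δ₁ v t → PVsTyped Δ₂ vs ts → PVsTyped Δ (v :: vs) (t :: ts)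

/-- Typing judgment `Δ ⊢ P` of the standard linear π-calculus:
linear output/input channels are used exactly once, `∅[]` channels cannot
be used, contexts are split linearly between parallel components. -/
inductive PTyped : PCtx → PProc → Prop
  | nil : ∀ {Δ}, unrPCtx Δ → PTyped Δ .nil
  | send : ∀ {Δ Δ₁ Δ₂ Δ₃ Δ₄ : PCtx} {x n} {ts : Fin n → PiTy} {vs P},
      PSplit Δ Δ₁ Δ₂ → PSplit Δ₂ Δ₃ Δ₄ → onlyAt Δ₁ x (.lout n ts) →
      PVsTyped Δ₃ vs (List.ofFn ts) → PTyped Δ₄ P → PTyped Δ (.send x vs P)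
  | recv : ∀ {Δ Δ₁ Δ₂ : PCtx} {x n} {ts : Fin n → PiTy} {ys P},
      PSplit Δ Δ₁ Δ₂ → onlyAt Δ₁ x (.lin n ts) → ys.length = n → ys.Nodup →
      (∀ y ∈ ys, Δ₂ y = none) →
      PTyped (pupdL Δ₂ ys (List.ofFn ts)) P → PTyped Δ (.recv x ys P)
  | res : ∀ {Δ : PCtx} {x t P}, Δ x = none →
      PTyped (pupd Δ x t) P → PTyped Δ (.res x P)
  | par : ∀ {Δ Δ₁ Δ₂ : PCtx} {P Q}, PSplit Δ Δ₁ Δ₂ →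
      PTyped Δ₁ P → PTyped Δ₂ Q → PTyped Δ (.par P Q)
  | case : ∀ {Δ Δ₁ Δ₂ : PCtx} {v} {I : Finset ℕ} {ts : ∀ i ∈ I, PiTy}
      {g : ∀ i ∈ I, ℕ} {f : ∀ i ∈ I, PProc},
      PSplit Δ Δ₁ Δ₂ → PVTyped Δ₁ v (.variant I ts) →
      (∀ i (h : i ∈ I), PTyped (pupd Δ₂ (g i h) (ts i h)) (f i h)) →
      PTyped Δ (.case v I g f)

/-! ### Encoding of processes -/

/-- A canonical fresh name not belonging to a finite set of names. -/
def freshName (s : Finset ℕ) : ℕ := s.sup id + 1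

/-- Encoding of values, `⟦x⟧_f = f(x)` and `⟦★⟧_f = ★`. -/
def encV (f : ℕ → ℕ) : SVal → PVal
  | .name x => .name (f x)
  | .star => .star

/-- The encoding `⟦P⟧_f` of session processes into linear π processes,
parametrised by a renaming function `f`.  Each communication sends along a
fresh linear continuation channel `c`, and `f` is updated accordingly. -/
def encP (f : ℕ → ℕ) : SProc → PProc
  | .send x v P =>
      let A := insert x (fnV v ∪ namesS P)
      let c := freshName (A ∪ A.image f)
      .res c (.send (f x) [encV f v, .name c] (encP (Function.update f x c) P))
  | .recv x y P =>
      let A := insert x (insert y (namesS P))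
      let c := freshName (A ∪ A.image f)
      .recv (f x) [y, c] (encP (Function.update f x c) P)
  | .sel x j P =>
      let A := insert x (namesS P)
      let c := freshName (A ∪ A.image f)
      .res c (.send (f x) [.variant j (.name c)] (encP (Function.update f x c) P))
  | .bra x I g =>
      let A := insert x (I.attach.sup fun i => namesS (g i.1 i.2))
      let y := freshName (A ∪ A.image f)
      let c := y + 1
      .recv (f x) [y]
        (.case (.name y) I (fun _ _ => c) (fun i h => encP (Function.update f x c) (g i h)))
  | .nil => .nil
  | .par P Q => .par (encP f P) (encP f Q)
  | .resS x y P =>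
      let A := insert x (insert y (namesS P))
      let c := freshName (A ∪ A.image f)
      .res c (encP (Function.update (Function.update f x c) y c) P)
  | .resC x P => .res x (encP f P)

/-- `f` is a renaming function for `P` (with respect to the context `Γ`):
for every free name `x` of `P`, either `f x = x` or `f x` is fresh
(not occurring in `P` nor in `Γ`), and `f` is the identity on bound names. -/
def IsRenaming (f : ℕ → ℕ) (P : SProc) (Γ : SCtx) : Prop :=
  (∀ x ∈ fnS P, f x = x ∨ (f x ∉ namesS P ∧ Γ (f x) = none)) ∧
  (∀ x ∈ bnS P, f x = x)

/-- `Δ` is the encoding `⟦Γ⟧_f` of the session context `Γ`: each entry `x : T`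
becomes `f(x) : ⟦T⟧`, and `Δ` is empty outside the image of the domain of `Γ`. -/
def EncCtx (f : ℕ → ℕ) (Γ : SCtx) (Δ : PCtx) : Prop :=
  (∀ x T, Γ x = some T → Δ (f x) = some (encTy T)) ∧
  (∀ z, (∀ x, Γ x ≠ none → f x ≠ z) → Δ z = none)

/-- The empty typing context. -/
def emptySCtx : SCtx := fun _ => none

/-- The deadlocked process
`(νx₁x₂)(νy₁y₂)( x₁?(z).y₁!⟨z⟩.0 | y₂?(w).x₂!⟨w⟩.0 )`,
with `x₁,x₂,y₁,y₂,z,w` rendered as the names `1,2,3,4,5,6`. -/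
def deadlockProc : SProc :=
  .resS 1 2 (.resS 3 4 (.par
    (.recv 1 5 (.send 3 (.name 5) .nil))
    (.recv 4 6 (.send 2 (.name 6) .nil))))

/-- A process is quiet if every output and every selection occurs under an input or a branching. -/
def Quiet : SProc → Prop
  | .send _ _ _ => False
  | .recv _ _ _ => True
  | .sel _ _ _ => False
  | .bra _ _ _ => True
  | .nil => True
  | .par P Q => Quiet P ∧ Quiet Q
  | .resS _ _ P => Quiet P
  | .resC _ P => Quiet P

theorem quiet_ssubst (z : ℕ) (v : SVal) (P : SProc) : Quiet (ssubst z v P) ↔ Quiet P := by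
  induction P with
  | par P Q ihP ihQ => simp [ssubst, Quiet, ihP, ihQ]
  | resS x y P ih => simp only [ssubst, Quiet]; split_ifs <;> simp [ih]
  | resC x P ih => simp only [ssubst, Quiet]; split_ifs <;> simp [ih]
  | _ => simp [ssubst, Quiet]

theorem SCong.quiet_iff {P Q : SProc} (h : SCong P Q) : Quiet P ↔ Quiet Q := by
  induction h with
  | symm _ ih => exact ih.symm
  | trans _ _ ih₁ ih₂ => exact ih₁.trans ih₂
  | _ => simp_all [Quiet, quiet_ssubst, and_comm, and_assoc]

theorem SRed.not_quiet {P Q : SProc} (h : SRed P Q) : ¬ Quiet P := by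
  induction h with
  | struct hc _ _ ih => rwa [hc.quiet_iff]
  | _ => simp_all [Quiet]

/-- A forwarder `x?(z).y!⟨z⟩.0` is typed by any context that is linear only at its two endpoints
`x : ?Unit.end` and `y : !Unit.end`. -/
theorem styped_forwarder {x y z : ℕ} (hxy : x ≠ y) (hzx : z ≠ x) (hzy : z ≠ y) :
    STyped (supd (supd emptySCtx x (.session (.recv .unit .done)))
        y (.session (.send .unit .done)))
      (.recv x z (.send y (.name z) .nil)) := by
  refine .recv (T := .unit) (S := .done) ?_ hzx ?_
    (.send (Γ₁ := supd emptySCtx z .unit)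
      (Γ₂ := supd (supd emptySCtx x (.session .done)) y (.session (.send .unit .done)))
      (T := .unit) (S := .done) ?_ (.name ?_ ?_) ?_ (.nil ?_))
  · simp [supd, hxy]
  · simp [supd, emptySCtx, hzx, hzy]
  · intro n
    simp only [supd, emptySCtx]
    grind
  · simp [supd]
  · intro n hn T hT
    simp [supd, emptySCtx, hn] at hT
  · simp [supd]
  · intro n T hT
    simp only [supd, emptySCtx] at hT
    split_ifs at hT <;> cases hT <;> rfl

/-- Well-typedness does not imply deadlock freedom: the process
`(νx₁x₂)(νy₁y₂)( x₁?(z).y₁!⟨z⟩.0 | y₂?(w).x₂!⟨w⟩.0 )` is well typed under the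
empty context, yet it admits no reduction step. -/
theorem welltyped_deadlock :
    STyped emptySCtx deadlockProc ∧ ¬ ∃ Q, SRed deadlockProc Q := by
  refine ⟨?_, fun ⟨_, h⟩ => h.not_quiet ⟨trivial, trivial⟩⟩
  refine .resS (T := .recv .unit .done) (by decide) rfl rfl
    (.resS (T := .send .unit .done) (by decide) rfl rfl
      (.par ?_ (styped_forwarder (by decide) (by decide) (by decide))
        (styped_forwarder (by decide) (by decide) (by decide))))
  intro n
  simp only [supd, emptySCtx, dual]
  grind

end SessionPi
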